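/- For every constant 0 < μ < 1 there is an n₀ such that the following holds for all n ≥ n₀. Let G be a connected δ-hyperbolic graph (δ ≥ 1/2) on n nodes with maximum degree d > 2, and suppose its diameter D = D(G) satisfies D ≥ log n / log d. Then the minimum node expansion satisfies ĥ_G ≤ min{ 8·ln(n/2)/D , max{ (1/D)^{1−μ} , 500·ln n/(D · 2^{D^μ/(28·δ·log(2d))}) } }, and consequently ĥ_G < max{ (log d/log n)^{1−μ} , 500·log d / 2^{ (log n)^μ / (28·δ·(log(2d))^{1+μ}) } }. -/

import Mathlib

open scoped Classical
open Real

namespace PaperHyp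

/-- Four-point condition for Gromov δ-hyperbolicity. -/
def IsHyp {V : Type*} (G : SimpleGraph V) (δ : ℝ) : Prop :=
  ∀ u₁ u₂ u₃ u₄ : V,
    let s₁ : ℝ := G.dist u₁ u₂ + G.dist u₃ u₄
    let s₂ : ℝ := G.dist u₁ u₃ + G.dist u₂ u₄
    let s₃ : ℝ := G.dist u₁ u₄ + G.dist u₂ u₃
    max s₁ (max s₂ s₃) - (s₁ + s₂ + s₃ - max s₁ (max s₂ s₃) - min s₁ (min s₂ s₃)) ≤ 2 * δ

/-- The node boundary ∂_G(S). -/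
noncomputable def nodeBoundary {V : Type*} (G : SimpleGraph V) [Fintype V] (S : Finset V) :
    Finset V :=
  Finset.univ.filter fun u => u ∉ S ∧ ∃ v ∈ S, G.Adj u v

/-- The node expansion ratio h_G(S) = |∂_G(S)| / |S|. -/
noncomputable def hexp {V : Type*} (G : SimpleGraph V) [Fintype V] (S : Finset V) : ℝ :=
  (nodeBoundary G S).card / S.card

/-- The minimum node expansion ĥ_G over nonempty subsets of at most half the nodes. -/
noncomputable def minExpansion {V : Type*} (G : SimpleGraph V) [Fintype V] : ℝ :=
  sInf {x : ℝ | ∃ S : Finset V, S.Nonempty ∧ 2 * S.card ≤ Fintype.card V ∧ hexp G S = x}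

/-- The diameter D(G) = max over pairs of nodes of the distance. -/
noncomputable def diam {V : Type*} (G : SimpleGraph V) [Fintype V] : ℕ :=
  Finset.univ.sup fun uv : V × V => G.dist uv.1 uv.2

section Graph

variable {V : Type*} {G : SimpleGraph V} {δ : ℝ}

/-- The Gromov product of `x` and `y` based at `m`. -/
noncomputable def gromovProd (G : SimpleGraph V) (m x y : V) : ℝ :=
  ((G.dist m x : ℝ) + G.dist m y - G.dist x y) / 2

lemma IsHyp.min_gromovProd_le (h : IsHyp G δ) (m x y z : V) :
    min (gromovProd G m x y) (gromovProd G m y z) - δ ≤ gromovProd G m x z := by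
  have h1 := h m y x z
  have e1 : G.dist y x = G.dist x y := G.dist_comm
  simp only [e1] at h1
  unfold gromovProd
  simp only [max_def, min_def] at h1 ⊢
  split_ifs at h1 ⊢ <;> linarith

lemma IsHyp.le_gromovProd_chain (h : IsHyp G δ) (m : V) (p : ℕ → V) (c : ℝ)
    (hp : ∀ i, c ≤ gromovProd G m (p i) (p (i + 1))) (k s : ℕ) :
    c - k * δ ≤ gromovProd G m (p s) (p (s + 2 ^ k)) := by
  induction k generalizing s with
  | zero => simpa using hp s
  | succ k ih =>
    have h1 := ih s
    have h2 := ih (s + 2 ^ k)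
    have h3 := h.min_gromovProd_le m (p s) (p (s + 2 ^ k)) (p (s + 2 ^ k + 2 ^ k))
    have h4 := le_min h1 h2
    rw [pow_succ, mul_two, ← add_assoc]
    push_cast
    linarith

lemma dist_le_of_step (hG : G.Connected) {x : ℕ → V} (hx : ∀ j, G.dist (x j) (x (j + 1)) ≤ 1)
    (s t : ℕ) : G.dist (x s) (x (s + t)) ≤ t := by
  induction t with
  | zero => simp
  | succ t ih =>
    have h1 := hG.dist_triangle (u := x s) (v := x (s + t)) (w := x (s + t + 1))
    have h2 := hx (s + t)
    rw [← add_assoc]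
    omega

/-- A path staying far from `m` has endpoints with large Gromov product at `m`, unless it is
exponentially long. -/
lemma IsHyp.le_gromovProd_of_step (h : IsHyp G δ) (hG : G.Connected) {x : ℕ → V}
    (hx : ∀ j, G.dist (x j) (x (j + 1)) ≤ 1) {m : V} {α : ℕ} (hm : ∀ j, α ≤ G.dist m (x j))
    (σ κ s : ℕ) :
    (α : ℝ) - σ / 2 - κ * δ ≤ gromovProd G m (x s) (x (s + σ * 2 ^ κ)) := by
  have key := h.le_gromovProd_chain m (fun i => x (s + σ * i)) (α - σ / 2) (fun i => by
    have h1 : (G.dist (x (s + σ * i)) (x (s + σ * i + σ)) : ℝ) ≤ σ := by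
      exact_mod_cast dist_le_of_step hG hx _ _
    have h2 : (α : ℝ) ≤ G.dist m (x (s + σ * i)) := by exact_mod_cast hm _
    have h3 : (α : ℝ) ≤ G.dist m (x (s + σ * i + σ)) := by exact_mod_cast hm _
    have h4 : s + σ * (i + 1) = s + σ * i + σ := by ring
    simp only [gromovProd, h4]
    linarith) κ 0
  simpa using key

/-- The (signed) position along a geodesic from `u` to `v` of the projection of `x`. -/
noncomputable def proj (G : SimpleGraph V) (u v x : V) : ℝ :=
  ((G.dist x u : ℝ) - G.dist x v + G.dist u v) / 2

lemma IsHyp.gromovProd_le_of_proj (h : IsHyp G δ) (hG : G.Connected) {u v m x y : V}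
    (hm : G.dist u m + G.dist m v = G.dist u v)
    (hx : proj G u v x + 2 * δ < G.dist u m) (hy : G.dist u m + 2 * δ < proj G u v y) :
    gromovProd G m x y ≤ 2 * δ := by
  have hm' : (G.dist u m : ℝ) + G.dist m v = G.dist u v := by exact_mod_cast hm
  have t1 : (G.dist x v : ℝ) ≤ G.dist m x + G.dist m v := by
    have := hG.dist_triangle (u := x) (v := m) (w := v)
    rw [G.dist_comm (u := x) (v := m)] at this
    exact_mod_cast this
  have t2 : (G.dist y u : ℝ) ≤ G.dist m y + G.dist u m := by
    have := hG.dist_triangle (u := y) (v := m) (w := u)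
    rw [G.dist_comm (u := y) (v := m), G.dist_comm (u := m) (v := u)] at this
    exact_mod_cast this
  unfold proj at hx hy
  have g1 : 2 * δ < gromovProd G m u x := by
    rw [gromovProd, G.dist_comm (u := m) (v := u), G.dist_comm (u := u) (v := x)]
    linarith
  have g2 : 2 * δ < gromovProd G m y v := by
    rw [gromovProd]
    linarith
  have g3 : gromovProd G m u v = 0 := by
    rw [gromovProd, G.dist_comm (u := m) (v := u)]
    linarith
  by_contra! hc
  have k1 := h.min_gromovProd_le m u x y
  have k2 := h.min_gromovProd_le m u y v
  have k3 : 2 * δ < min (gromovProd G m u x) (gromovProd G m x y) := lt_min g1 hc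
  by_cases hδ : 0 ≤ δ
  · have k4 : δ < min (gromovProd G m u y) (gromovProd G m y v) :=
      lt_min (by linarith) (by linarith)
    linarith
  · have k5 := h u u u u
    simp only [SimpleGraph.dist_self] at k5
    norm_num at k5
    linarith

/-- The projection truncated to the middle third of the geodesic. -/
noncomputable def midProj (G : SimpleGraph V) (u v x : V) : ℝ :=
  max ((G.dist u v : ℝ) / 3) (min (2 * (G.dist u v : ℝ) / 3) (proj G u v x))

/-- The sequence `x` avoids the `α`-neighbourhood of the middle third of the geodesic `p`. -/
def AvoidsMiddle (G : SimpleGraph V) (u v : V) (p : ℕ → V) (α : ℕ) (x : ℕ → V) : Prop :=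
  ∀ r : ℕ, (G.dist u v : ℝ) / 3 < r → (r : ℝ) < 2 * (G.dist u v : ℝ) / 3 →
    ∀ j, α ≤ G.dist (p r) (x j)

lemma IsHyp.gromovProd_le_of_midProj (h : IsHyp G δ) (hG : G.Connected) (hδ : 1 / 2 ≤ δ)
    {u v : V} {p : ℕ → V}
    (hp : ∀ r ≤ G.dist u v, G.dist u (p r) = r ∧ G.dist u (p r) + G.dist (p r) v = G.dist u v)
    {x y : V} (hxy : midProj G u v x + (4 * δ + 1) < midProj G u v y) :
    ∃ r : ℕ, (G.dist u v : ℝ) / 3 < r ∧ (r : ℝ) < 2 * (G.dist u v : ℝ) / 3 ∧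
      gromovProd G (p r) x y ≤ 2 * δ := by
  have hD : (0 : ℝ) ≤ G.dist u v := Nat.cast_nonneg _
  have x1 : (G.dist u v : ℝ) / 3 ≤ midProj G u v x := le_max_left _ _
  have y1 : midProj G u v y ≤ 2 * (G.dist u v : ℝ) / 3 :=
    max_le (by linarith) (min_le_left _ _)
  have x2 : proj G u v x ≤ midProj G u v x := by
    have : min (2 * (G.dist u v : ℝ) / 3) (proj G u v x) ≤ midProj G u v x := le_max_right _ _
    rcases min_le_iff.1 this with h' | h' <;> linarith
  have y2 : midProj G u v y ≤ proj G u v y := by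
    have : midProj G u v y ≤ max ((G.dist u v : ℝ) / 3) (proj G u v y) :=
      max_le_max le_rfl (min_le_right _ _)
    rcases le_max_iff.1 this with h' | h' <;> linarith
  have f1 := Nat.lt_floor_add_one (midProj G u v x + 2 * δ)
  have f2 := Nat.floor_le (show 0 ≤ midProj G u v x + 2 * δ by linarith)
  set r : ℕ := ⌊midProj G u v x + 2 * δ⌋₊ + 1 with hr
  have hr' : (r : ℝ) = (⌊midProj G u v x + 2 * δ⌋₊ : ℝ) + 1 := by rw [hr]; push_cast; rfl
  rw [← hr'] at f1
  have hrD : r ≤ G.dist u v := by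
    have : (r : ℝ) ≤ G.dist u v := by linarith
    exact_mod_cast this
  obtain ⟨p1, p2⟩ := hp r hrD
  refine ⟨r, by linarith, by linarith, h.gromovProd_le_of_proj hG p2 ?_ ?_⟩ <;>
    rw [p1] <;> linarith

lemma IsHyp.midProj_step (h : IsHyp G δ) (hG : G.Connected) (hδ : 1 / 2 ≤ δ)
    {u v : V} {p : ℕ → V}
    (hp : ∀ r ≤ G.dist u v, G.dist u (p r) = r ∧ G.dist u (p r) + G.dist (p r) v = G.dist u v)
    {α σ κ : ℕ} (hα : (σ : ℝ) / 2 + κ * δ + 2 * δ < α) {x : ℕ → V}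
    (hx : ∀ j, G.dist (x j) (x (j + 1)) ≤ 1) (hav : AvoidsMiddle G u v p α x) (s : ℕ) :
    |midProj G u v (x s) - midProj G u v (x (s + σ * 2 ^ κ))| ≤ 4 * δ + 1 := by
  rw [abs_le]
  constructor
  · by_contra! hc
    obtain ⟨r, r1, r2, r3⟩ := h.gromovProd_le_of_midProj hG hδ hp
      (x := x s) (y := x (s + σ * 2 ^ κ)) (by linarith)
    have := h.le_gromovProd_of_step hG hx (hav r r1 r2) σ κ s
    linarith
  · by_contra! hc
    obtain ⟨r, r1, r2, r3⟩ := h.gromovProd_le_of_midProj hG hδ hp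
      (y := x s) (x := x (s + σ * 2 ^ κ)) (by linarith)
    have := h.le_gromovProd_of_step hG hx (hav r r1 r2) σ κ s
    have e : gromovProd G (p r) (x (s + σ * 2 ^ κ)) (x s)
        = gromovProd G (p r) (x s) (x (s + σ * 2 ^ κ)) := by
      rw [gromovProd, gromovProd, G.dist_comm (u := x (s + σ * 2 ^ κ)) (v := x s)]; ring
    linarith

lemma IsHyp.midProj_steps (h : IsHyp G δ) (hG : G.Connected) (hδ : 1 / 2 ≤ δ)
    {u v : V} {p : ℕ → V}
    (hp : ∀ r ≤ G.dist u v, G.dist u (p r) = r ∧ G.dist u (p r) + G.dist (p r) v = G.dist u v)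
    {α σ κ : ℕ} (hα : (σ : ℝ) / 2 + κ * δ + 2 * δ < α) {x : ℕ → V}
    (hx : ∀ j, G.dist (x j) (x (j + 1)) ≤ 1) (hav : AvoidsMiddle G u v p α x) (M : ℕ) :
    |midProj G u v (x 0) - midProj G u v (x (M * (σ * 2 ^ κ)))| ≤ M * (4 * δ + 1) := by
  induction M with
  | zero => simp
  | succ M ih =>
    have h1 := h.midProj_step hG hδ hp hα hx hav (M * (σ * 2 ^ κ))
    have h2 := abs_sub_le (midProj G u v (x 0)) (midProj G u v (x (M * (σ * 2 ^ κ))))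
      (midProj G u v (x (M * (σ * 2 ^ κ) + σ * 2 ^ κ)))
    rw [add_one_mul M]
    push_cast
    linarith

lemma exists_geodesic (hG : G.Connected) (u v : V) : ∃ p : ℕ → V, ∀ r ≤ G.dist u v,
    G.dist u (p r) = r ∧ G.dist u (p r) + G.dist (p r) v = G.dist u v := by
  obtain ⟨w, hw⟩ := hG.exists_walk_length_eq_dist u v
  refine ⟨w.getVert, fun r hr => ?_⟩
  have h1 := SimpleGraph.dist_le (w.take r)
  have h2 := SimpleGraph.dist_le (w.drop r)
  have h3 := hG.dist_triangle (u := u) (v := w.getVert r) (w := v)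
  rw [SimpleGraph.Walk.take_length] at h1
  rw [SimpleGraph.Walk.drop_length] at h2
  omega

end Graph

section Growth

variable {V : Type*} [Fintype V] {G : SimpleGraph V}

/-- Closed ball of radius `r` in the graph metric. -/
noncomputable def gball (G : SimpleGraph V) (u : V) (r : ℕ) : Finset V :=
  Finset.univ.filter fun x => G.dist u x ≤ r

/-- Sets obtained from `S` by repeatedly adding the boundary nodes outside of `C`. -/
noncomputable def grow (G : SimpleGraph V) (C S : Finset V) : ℕ → Finset V
  | 0 => S
  | i + 1 => grow G C S i ∪ (nodeBoundary G (grow G C S i) \ C)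

lemma minExpansion_mul_card_le {S : Finset V} (hS : 2 * S.card ≤ Fintype.card V) :
    minExpansion G * S.card ≤ (nodeBoundary G S).card := by
  rcases S.eq_empty_or_nonempty with rfl | hne
  · simp
  have hpos : (0 : ℝ) < S.card := by exact_mod_cast hne.card_pos
  have hle : minExpansion G ≤ hexp G S := by
    refine csInf_le ⟨0, ?_⟩ ⟨S, hne, hS, rfl⟩
    rintro _ ⟨T, -, -, rfl⟩
    unfold hexp
    positivity
  rwa [hexp, le_div_iff₀ hpos] at hle

lemma minExpansion_lt_two (hn : 4 ≤ Fintype.card V) : minExpansion G < 2 := by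
  obtain ⟨S, -, hS⟩ := Finset.exists_subset_card_eq
    (s := (Finset.univ : Finset V)) (n := Fintype.card V / 2) (by
      rw [Finset.card_univ]; omega)
  have h1 := minExpansion_mul_card_le (G := G) (S := S) (by omega)
  have h2 : (nodeBoundary G S).card ≤ Fintype.card V - S.card := by
    rw [← Finset.card_compl]
    refine Finset.card_le_card fun x hx => ?_
    simp only [nodeBoundary, Finset.mem_filter] at hx
    simpa using hx.2.1
  have h3 : (nodeBoundary G S).card < 2 * S.card := by omega
  have h4 : ((nodeBoundary G S).card : ℝ) < 2 * S.card := by exact_mod_cast h3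
  exact lt_of_mul_lt_mul_right (h1.trans_lt h4) (Nat.cast_nonneg _)

lemma card_nodeBoundary_le [DecidableRel G.Adj] {d : ℕ} (hd : ∀ v, G.degree v ≤ d)
    (S : Finset V) : (nodeBoundary G S).card ≤ S.card * d := by
  calc (nodeBoundary G S).card ≤ (S.biUnion fun v => G.neighborFinset v).card := by
        refine Finset.card_le_card fun x hx => ?_
        simp only [nodeBoundary, Finset.mem_filter] at hx
        obtain ⟨-, -, v, hv, hxv⟩ := hx
        simp only [Finset.mem_biUnion, SimpleGraph.mem_neighborFinset]
        exact ⟨v, hv, hxv.symm⟩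
    _ ≤ S.card * d := Finset.card_biUnion_le_card_mul _ _ _ fun v _ => hd v

lemma gball_succ (hG : G.Connected) (u : V) (r : ℕ) :
    gball G u (r + 1) = gball G u r ∪ nodeBoundary G (gball G u r) := by
  ext x
  simp only [gball, nodeBoundary, Finset.mem_union, Finset.mem_filter, Finset.mem_univ, true_and]
  constructor
  · intro hx
    by_cases hxr : G.dist u x ≤ r
    · exact Or.inl hxr
    refine Or.inr ⟨hxr, ?_⟩
    obtain ⟨p, hp⟩ := exists_geodesic hG u x
    obtain ⟨h1, h2⟩ := hp r (by omega)
    refine ⟨p r, h1.le, ?_⟩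
    rw [G.adj_comm, ← SimpleGraph.dist_eq_one_iff_adj]
    omega
  · rintro (hx | ⟨-, y, hy, hxy⟩)
    · omega
    · have h1 := hG.dist_triangle (u := u) (v := y) (w := x)
      have h2 := SimpleGraph.dist_eq_one_iff_adj.2 hxy.symm
      omega

lemma gball_zero (hG : G.Connected) (u : V) : gball G u 0 = {u} := by
  ext x
  simp [gball, hG.dist_eq_zero_iff, eq_comm]

lemma card_gball_le [DecidableRel G.Adj] (hG : G.Connected) {d : ℕ} (hd : ∀ v, G.degree v ≤ d)
    (u : V) (r : ℕ) : (gball G u r).card ≤ (d + 1) ^ r := by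
  induction r with
  | zero => simp [gball_zero hG]
  | succ r ih =>
    rw [gball_succ hG]
    calc _ ≤ _ := Finset.card_union_le _ _
      _ ≤ (gball G u r).card + (gball G u r).card * d := by
        gcongr; exact card_nodeBoundary_le hd _
      _ = (gball G u r).card * (d + 1) := by ring
      _ ≤ (d + 1) ^ r * (d + 1) := by gcongr
      _ = (d + 1) ^ (r + 1) := (pow_succ _ _).symm

lemma card_grow_ge {C S : Finset V} {B β : ℝ} (hβ : 0 ≤ β) (hB : B ≤ minExpansion G)
    (hC : (C.card : ℝ) ≤ (B - β) * S.card) (hβB : β ≤ B) {k : ℕ}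
    (hk : 2 * (grow G C S k).card ≤ Fintype.card V) :
    (1 + β) ^ k * S.card ≤ (grow G C S k).card := by
  induction k with
  | zero => simp [grow]
  | succ k ih =>
    have hsub : grow G C S k ⊆ grow G C S (k + 1) := by
      rw [grow]; exact Finset.subset_union_left
    have hle := Finset.card_le_card hsub
    have ih' := ih (by omega)
    have h1 := minExpansion_mul_card_le (G := G) (S := grow G C S k) (by omega)
    have h2 : (grow G C S k).card + (nodeBoundary G (grow G C S k)).card
        ≤ (grow G C S (k + 1)).card + C.card := by
      rw [grow, Finset.card_union_of_disjoint]
      · have := Finset.card_le_card_sdiff_add_card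
          (s := nodeBoundary G (grow G C S k)) (t := C)
        omega
      · rw [Finset.disjoint_left]
        intro x hx hx'
        simp only [nodeBoundary, Finset.mem_sdiff, Finset.mem_filter] at hx'
        exact hx'.1.2.1 hx
    have h2' : ((grow G C S k).card : ℝ) + (nodeBoundary G (grow G C S k)).card
        ≤ (grow G C S (k + 1)).card + C.card := by exact_mod_cast h2
    have hS : (S.card : ℝ) ≤ (grow G C S k).card := by
      refine le_trans ?_ ih'
      exact le_mul_of_one_le_left (Nat.cast_nonneg _) (one_le_pow₀ (by linarith))
    have h3 : B * (grow G C S k).card ≤ minExpansion G * (grow G C S k).card := by gcongr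
    have h4 : (B - β) * S.card ≤ (B - β) * (grow G C S k).card :=
      mul_le_mul_of_nonneg_left hS (by linarith)
    calc (1 + β) ^ (k + 1) * S.card = (1 + β) * ((1 + β) ^ k * S.card) := by ring
      _ ≤ (1 + β) * (grow G C S k).card := by gcongr
      _ ≤ _ := by linarith

lemma gball_eq_grow (hG : G.Connected) (u : V) (r : ℕ) : gball G u r = grow G ∅ {u} r := by
  induction r with
  | zero => exact gball_zero hG u
  | succ r ih => rw [gball_succ hG, grow, ← ih, Finset.sdiff_empty]

lemma card_gball_ge (hG : G.Connected) {B : ℝ} (hB0 : 0 ≤ B) (hB : B ≤ minExpansion G) {u : V}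
    {r : ℕ} (hr : 2 * (gball G u r).card ≤ Fintype.card V) :
    (1 + B) ^ r ≤ (gball G u r).card := by
  rw [gball_eq_grow hG] at hr ⊢
  simpa using card_grow_ge hB0 hB (by simp) le_rfl hr

lemma subset_grow (C S : Finset V) (k : ℕ) : S ⊆ grow G C S k := by
  induction k with
  | zero => exact subset_rfl
  | succ k ih => rw [grow]; exact ih.trans Finset.subset_union_left

lemma exists_seq_of_mem_grow {C S : Finset V} (hSC : Disjoint S C) (k : ℕ) :
    ∀ {z : V}, z ∈ grow G C S k → ∃ x : ℕ → V, x 0 ∈ S ∧ x k = z ∧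
      (∀ j, G.dist (x j) (x (j + 1)) ≤ 1) ∧ ∀ j, x j ∉ C := by
  induction k with
  | zero =>
    intro z hz
    exact ⟨fun _ => z, hz, rfl, by simp, fun _ => Finset.disjoint_left.1 hSC hz⟩
  | succ k ih =>
    intro z hz
    rw [grow, Finset.mem_union] at hz
    obtain ⟨y, hy, hyz, hzC⟩ : ∃ y ∈ grow G C S k, G.dist y z ≤ 1 ∧ (y = z ∨ z ∉ C) := by
      rcases hz with hz | hz
      · exact ⟨z, hz, by simp, Or.inl rfl⟩
      · simp only [nodeBoundary, Finset.mem_sdiff, Finset.mem_filter] at hz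
        obtain ⟨⟨-, -, y, hy, hzy⟩, hzC⟩ := hz
        exact ⟨y, hy, (SimpleGraph.dist_eq_one_iff_adj.2 hzy.symm).le, Or.inr hzC⟩
    obtain ⟨x, x0, xk, xs, xC⟩ := ih hy
    have hzMem : z ∉ C := by
      rcases hzC with rfl | h
      · exact xk ▸ xC k
      · exact h
    refine ⟨fun j => if j ≤ k then x j else z, by simpa using x0, by simp, fun j => ?_,
      fun j => ?_⟩
    · rcases lt_trichotomy j k with h | rfl | h
      · simpa [h.le, Nat.succ_le_of_lt h] using xs j
      · simpa [xk] using hyz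
      · simp [h.not_ge, (Nat.lt_succ_of_lt h).not_ge]
    · by_cases h : j ≤ k
      · simpa [h] using xC j
      · simpa [h] using hzMem

/-- The set of nodes close to the middle third of the geodesic `p` from `u` to `v`. -/
noncomputable def tube (G : SimpleGraph V) (u v : V) (p : ℕ → V) (α : ℕ) : Finset V :=
  ((Finset.range (G.dist u v + 1)).filter fun r : ℕ =>
    (G.dist u v : ℝ) / 3 < r ∧ (r : ℝ) < 2 * (G.dist u v : ℝ) / 3).biUnion
      fun r => gball G (p r) α

lemma card_tube_le [DecidableRel G.Adj] (hG : G.Connected) {d : ℕ} (hd : ∀ v, G.degree v ≤ d)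
    (u v : V) (p : ℕ → V) (α : ℕ) :
    (tube G u v p α).card ≤ (G.dist u v + 1) * (d + 1) ^ α := by
  refine (Finset.card_biUnion_le_card_mul _ _ _ fun r _ => card_gball_le hG hd (p r) α).trans ?_
  gcongr
  exact (Finset.card_filter_le _ _).trans (Finset.card_range _).le

lemma mem_tube {u v : V} {p : ℕ → V} {α : ℕ} {x : V} : x ∈ tube G u v p α ↔
    ∃ r : ℕ, (G.dist u v : ℝ) / 3 < r ∧ (r : ℝ) < 2 * (G.dist u v : ℝ) / 3 ∧
      G.dist (p r) x ≤ α := by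
  simp only [tube, gball, Finset.mem_biUnion, Finset.mem_filter, Finset.mem_range, Finset.mem_univ,
    true_and]
  constructor
  · rintro ⟨r, ⟨-, h1, h2⟩, h3⟩
    exact ⟨r, h1, h2, h3⟩
  · rintro ⟨r, h1, h2, h3⟩
    refine ⟨r, ⟨?_, h1, h2⟩, h3⟩
    have hD : (0 : ℝ) ≤ G.dist u v := Nat.cast_nonneg _
    have : (r : ℝ) < (G.dist u v + 1 : ℕ) := by push_cast; linarith
    exact_mod_cast this

lemma avoidsMiddle_of_notMem_tube {u v : V} {p : ℕ → V} {α : ℕ} {x : ℕ → V}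
    (h : ∀ j, x j ∉ tube G u v p α) : AvoidsMiddle G u v p α x := by
  intro r r1 r2 j
  by_contra! hc
  exact h j (mem_tube.2 ⟨r, r1, r2, hc.le⟩)

lemma disjoint_gball_tube (hG : G.Connected) {u v w : V} {p : ℕ → V} {r₀ α : ℕ}
    (hw : ∀ r : ℕ, (G.dist u v : ℝ) / 3 < r → (r : ℝ) < 2 * (G.dist u v : ℝ) / 3 →
      r₀ + α < G.dist w (p r)) :
    Disjoint (gball G w r₀) (tube G u v p α) := by
  rw [Finset.disjoint_left]
  intro x hx hx'
  obtain ⟨r, r1, r2, r3⟩ := mem_tube.1 hx'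
  simp only [gball, Finset.mem_filter, Finset.mem_univ, true_and] at hx
  have h1 := hw r r1 r2
  have h2 := hG.dist_triangle (u := w) (v := x) (w := p r)
  rw [G.dist_comm (u := x) (v := p r)] at h2
  omega

lemma one_add_half_pow_le (hG : G.Connected) {B : ℝ} (hB0 : 0 ≤ B) (hB : B ≤ minExpansion G)
    {C : Finset V} {w : V} {r₀ k : ℕ} (hC : (C.card : ℝ) ≤ B / 2 * (1 + B) ^ r₀)
    (hk : 2 * (grow G C (gball G w r₀) k).card ≤ Fintype.card V) :
    (1 + B / 2) ^ k ≤ (Fintype.card V : ℝ) / 2 := by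
  have hsub := Finset.card_le_card (subset_grow (G := G) C (gball G w r₀) k)
  have h1 := card_gball_ge hG hB0 hB (u := w) (r := r₀) (by omega)
  have h2 := card_grow_ge (β := B / 2) (by linarith) hB (C := C) (S := gball G w r₀)
    (hC.trans (by
      have : B - B / 2 = B / 2 := by ring
      rw [this]; gcongr)) (by linarith) hk
  have h3 : (2 : ℝ) * (grow G C (gball G w r₀) k).card ≤ Fintype.card V := by exact_mod_cast hk
  have h4 : (1 : ℝ) ≤ (gball G w r₀).card := le_trans (one_le_pow₀ (by linarith)) h1
  have h5 : (1 + B / 2) ^ k ≤ (1 + B / 2) ^ k * (gball G w r₀).card :=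
    le_mul_of_one_le_right (by positivity) h4
  linarith

lemma two_mul_card_le_or {S T : Finset V} (h : Disjoint S T) :
    2 * S.card ≤ Fintype.card V ∨ 2 * T.card ≤ Fintype.card V := by
  have := Finset.card_le_univ (S ∪ T)
  rw [Finset.card_union_of_disjoint h] at this
  omega

lemma one_add_pow_le_of_two_mul_lt (hG : G.Connected) {B : ℝ} (hB0 : 0 ≤ B)
    (hB : B ≤ minExpansion G) {u v : V} {r : ℕ} (hr : 2 * r < G.dist u v) :
    (1 + B) ^ r ≤ (Fintype.card V : ℝ) / 2 := by
  have hdisj : Disjoint (gball G u r) (gball G v r) := by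
    rw [Finset.disjoint_left]
    intro x hx hx'
    simp only [gball, Finset.mem_filter, Finset.mem_univ, true_and] at hx hx'
    have h2 := hG.dist_triangle (u := u) (v := x) (w := v)
    rw [G.dist_comm (u := x) (v := v)] at h2
    omega
  have key : ∀ w, 2 * (gball G w r).card ≤ Fintype.card V →
      (1 + B) ^ r ≤ (Fintype.card V : ℝ) / 2 := fun w hw => by
    have h1 := card_gball_ge hG hB0 hB hw
    have h3 : (2 : ℝ) * (gball G w r).card ≤ Fintype.card V := by exact_mod_cast hw
    linarith
  exact (two_mul_card_le_or hdisj).elim (key u) (key v)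

/-- Expansion outside of a tube around the middle of a geodesic, combined with the exponential
divergence of paths that avoid this tube. -/
lemma IsHyp.one_add_half_pow_le [DecidableRel G.Adj] {δ : ℝ} (h : IsHyp G δ) (hG : G.Connected)
    (hδ : 1 / 2 ≤ δ) {d : ℕ} (hd : ∀ v, G.degree v ≤ d) {B : ℝ} (hB0 : 0 ≤ B)
    (hB : B ≤ minExpansion G) {u v : V} {r₀ α σ κ M : ℕ}
    (hα : (σ : ℝ) / 2 + κ * δ + 2 * δ < α) (hr : (r₀ : ℝ) + α < (G.dist u v : ℝ) / 3)
    (hM : 2 * (M * (4 * δ + 1)) < (G.dist u v : ℝ) / 3)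
    (hK : ((G.dist u v : ℝ) + 1) * ((d : ℝ) + 1) ^ α ≤ B / 2 * (1 + B) ^ r₀) :
    (1 + B / 2) ^ (M * (σ * 2 ^ κ)) ≤ (Fintype.card V : ℝ) / 2 := by
  obtain ⟨p, hp⟩ := exists_geodesic hG u v
  have hD0 : (0 : ℝ) ≤ G.dist u v := Nat.cast_nonneg _
  have hα0 : (0 : ℝ) ≤ α := Nat.cast_nonneg _
  set C := tube G u v p α with hCdef
  have hC : (C.card : ℝ) ≤ B / 2 * (1 + B) ^ r₀ := by
    refine le_trans ?_ hK
    exact_mod_cast card_tube_le hG hd u v p α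
  have hpr : ∀ r : ℕ, (r : ℝ) < 2 * (G.dist u v : ℝ) / 3 → (G.dist u (p r) : ℝ) = r ∧
      (G.dist u (p r) : ℝ) + G.dist (p r) v = G.dist u v := fun r hr' => by
    have : r ≤ G.dist u v := by
      have : (r : ℝ) ≤ G.dist u v := by linarith
      exact_mod_cast this
    exact_mod_cast hp r this
  have du : Disjoint (gball G u r₀) C := disjoint_gball_tube hG fun r r1 r2 => by
    have : (r₀ : ℝ) + α < G.dist u (p r) := by rw [(hpr r r2).1]; linarith
    exact_mod_cast this
  have dv : Disjoint (gball G v r₀) C := disjoint_gball_tube hG fun r r1 r2 => by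
    have : (r₀ : ℝ) + α < G.dist v (p r) := by
      rw [G.dist_comm]
      have := hpr r r2
      linarith
    exact_mod_cast this
  have hdisj : Disjoint (grow G C (gball G u r₀) (M * (σ * 2 ^ κ)))
      (grow G C (gball G v r₀) (M * (σ * 2 ^ κ))) := by
    rw [Finset.disjoint_left]
    intro z hz hz'
    obtain ⟨x, x0, xk, xs, xC⟩ := exists_seq_of_mem_grow du _ hz
    obtain ⟨y, y0, yk, ys, yC⟩ := exists_seq_of_mem_grow dv _ hz'
    have h1 := h.midProj_steps hG hδ hp hα xs (avoidsMiddle_of_notMem_tube xC) M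
    have h2 := h.midProj_steps hG hδ hp hα ys (avoidsMiddle_of_notMem_tube yC) M
    rw [xk] at h1
    rw [yk] at h2
    simp only [gball, Finset.mem_filter, Finset.mem_univ, true_and] at x0 y0
    have x0' : (G.dist u (x 0) : ℝ) ≤ r₀ := by exact_mod_cast x0
    have y0' : (G.dist v (y 0) : ℝ) ≤ r₀ := by exact_mod_cast y0
    have tx : (G.dist u v : ℝ) ≤ G.dist u (x 0) + G.dist (x 0) v := by
      exact_mod_cast hG.dist_triangle
    have ty : (G.dist u v : ℝ) ≤ G.dist u (y 0) + G.dist (y 0) v := by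
      exact_mod_cast hG.dist_triangle
    have mx : midProj G u v (x 0) ≤ (G.dist u v : ℝ) / 3 := by
      refine max_le le_rfl ((min_le_right _ _).trans ?_)
      rw [proj, G.dist_comm (u := x 0) (v := u)]
      linarith
    have my : 2 * (G.dist u v : ℝ) / 3 ≤ midProj G u v (y 0) := by
      refine le_trans (le_min le_rfl ?_) (le_max_right _ _)
      rw [proj, G.dist_comm (u := y 0) (v := u)]
      rw [G.dist_comm (u := y 0) (v := v)] at ty ⊢
      linarith
    rw [abs_le] at h1 h2
    linarith [h1.1, h2.2]
  exact (two_mul_card_le_or hdisj).elim (PaperHyp.one_add_half_pow_le hG hB0 hB hC)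
    (PaperHyp.one_add_half_pow_le hG hB0 hB hC)

lemma exists_dist_eq_diam [Nonempty V] (G : SimpleGraph V) : ∃ u v, G.dist u v = diam G := by
  obtain ⟨uv, -, h⟩ := Finset.exists_mem_eq_sup (Finset.univ : Finset (V × V))
    Finset.univ_nonempty fun uv => G.dist uv.1 uv.2
  exact ⟨uv.1, uv.2, h.symm⟩

end Growth

section Bounds

variable {V : Type*} [Fintype V] {G : SimpleGraph V}

lemma minExpansion_lt_of_dist (hG : G.Connected) (hn : 16 ≤ Fintype.card V) {u v : V}
    (huv : 0 < G.dist u v) :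
    minExpansion G < 8 * Real.log ((Fintype.card V : ℝ) / 2) / G.dist u v := by
  by_contra! hB
  have hD : (0 : ℝ) < G.dist u v := by exact_mod_cast huv
  have hn' : (16 : ℝ) ≤ Fintype.card V := by exact_mod_cast hn
  have hL : 1 ≤ Real.log ((Fintype.card V : ℝ) / 2) := by
    rw [Real.le_log_iff_exp_le (by linarith)]
    linarith [Real.exp_one_lt_d9]
  set L := Real.log ((Fintype.card V : ℝ) / 2) with hLdef
  set B := 8 * L / G.dist u v with hBdef
  have hB0 : 0 ≤ B := by positivity
  have hB2 : B < 2 := hB.trans_lt (minExpansion_lt_two (by omega))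
  have hBD : B * G.dist u v = 8 * L := div_mul_cancel₀ _ hD.ne'
  obtain ⟨r, hr1, hr2⟩ : ∃ r, 2 * r < G.dist u v ∧ G.dist u v ≤ 2 * r + 2 :=
    ⟨(G.dist u v - 1) / 2, by omega, by omega⟩
  have h1 := one_add_pow_le_of_two_mul_lt hG hB0 hB hr1
  have h2 := Real.log_le_log (by positivity) h1
  rw [Real.log_pow, ← hLdef] at h2
  have h3 : B / 2 ≤ Real.log (1 + B) := by
    refine le_trans ?_ (Real.le_log_one_add_of_nonneg hB0)
    rw [div_le_div_iff₀ (by norm_num) (by linarith)]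
    nlinarith
  have h4 : (r : ℝ) * (B / 2) ≤ r * Real.log (1 + B) := by gcongr
  have h5 : (G.dist u v : ℝ) ≤ 2 * r + 2 := by exact_mod_cast hr2
  have h6 : B * G.dist u v ≤ B * (2 * r + 2) := by gcongr
  linarith

lemma two_rpow_le_one_add_pow {β B t : ℝ} (hβ0 : 0 ≤ β) (hβ1 : β ≤ 1) (hβB : β ≤ B) {r : ℕ}
    (ht : t ≤ β * r) : (2 : ℝ) ^ t ≤ (1 + B) ^ r := by
  have h1 : (2 : ℝ) ^ β ≤ 1 + β := by
    have := rpow_one_add_le_one_add_mul_self (s := 1) (by norm_num) hβ0 hβ1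
    norm_num at this
    exact this
  calc (2 : ℝ) ^ t ≤ 2 ^ (β * r) := Real.rpow_le_rpow_of_exponent_le (by norm_num) ht
    _ = ((2 : ℝ) ^ β) ^ r := by rw [Real.rpow_mul (by norm_num), Real.rpow_natCast]
    _ ≤ (1 + B) ^ r := by gcongr; linarith

set_option maxHeartbeats 1000000 in
lemma IsHyp.minExpansion_lt_of_dist [DecidableRel G.Adj] {δ : ℝ} (h : IsHyp G δ)
    (hG : G.Connected) (hδ : 1 / 2 ≤ δ) {d : ℕ} (hd2 : 2 < d) (hd : ∀ v, G.degree v ≤ d)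
    (hn : 16 ≤ Fintype.card V) {u v : V} (huv : 0 < G.dist u v) {μ : ℝ} (hμ0 : 0 < μ)
    (hμ1 : μ < 1) (hX : 5 < (G.dist u v : ℝ) ^ μ / (28 * δ * logb 2 (2 * d)))
    (hD : 4 * (G.dist u v : ℝ) ^ 2 ≤ 2 ^ ((G.dist u v : ℝ) ^ μ / 8)) :
    minExpansion G < max ((1 / (G.dist u v : ℝ)) ^ (1 - μ))
      (500 * Real.log (Fintype.card V) / ((G.dist u v : ℝ) *
        (2 : ℝ) ^ ((G.dist u v : ℝ) ^ μ / (28 * δ * logb 2 (2 * d))))) := by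
  by_contra! hB
  have hB2 := hB.trans_lt (minExpansion_lt_two (by omega))
  have hD1 : (1 : ℝ) ≤ G.dist u v := by exact_mod_cast huv
  have hlog : 0 < Real.log (Fintype.card V) := Real.log_pos (by
    have : (16 : ℝ) ≤ Fintype.card V := by exact_mod_cast hn
    linarith)
  have hd3 : (3 : ℝ) ≤ d := by exact_mod_cast hd2
  have hLg : 2 ≤ logb 2 (2 * d) := by
    rw [Real.le_logb_iff_rpow_le (by norm_num) (by linarith)]
    norm_num
    linarith
  have hLpow : (2 : ℝ) ^ logb 2 (2 * d) = 2 * d :=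
    Real.rpow_logb (by norm_num) (by norm_num) (by linarith)
  set D : ℝ := ((G.dist u v : ℕ) : ℝ) with hDdef
  set Lg := logb 2 (2 * d) with hLgdef
  set X := D ^ μ / (28 * δ * Lg) with hXdef
  set P := D ^ μ with hPdef
  have hPX : P = 28 * (X * δ) * Lg := by
    rw [hXdef]; field_simp
  have hPD : P ≤ D := by
    simpa using Real.rpow_le_rpow_of_exponent_le hD1 hμ1.le
  have hP1 : 1 ≤ P := Real.one_le_rpow hD1 hμ0.le
  have hXδ : 5 * δ ≤ X * δ := by gcongr
  have hXδD : 56 * (X * δ) ≤ D := by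
    have : 28 * (X * δ) * 2 ≤ 28 * (X * δ) * Lg := by
      apply mul_le_mul_of_nonneg_left hLg; linarith
    linarith
  set β := (1 / D) ^ (1 - μ) with hβdef
  have hβD : β * D = P := by
    rw [hβdef, one_div, Real.inv_rpow (by linarith), ← Real.rpow_neg (by linarith)]
    nth_rewrite 2 [← Real.rpow_one D]
    rw [← Real.rpow_add (by linarith)]
    congr 1; ring
  have hβ0 : 0 < β := by positivity
  have hβ1 : β ≤ 1 := by
    by_contra! hc
    have : 1 * D < β * D := by gcongr
    linarith
  set Q := 500 * Real.log (Fintype.card V) / (D * (2 : ℝ) ^ X) with hQdef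
  set B := max β Q with hBdef
  have hβB : β ≤ B := le_max_left _ _
  have hQB : Q ≤ B := le_max_right _ _
  have hB0 : 0 ≤ B := by linarith
  have κ1 := Nat.le_ceil X
  have κ2 := Nat.ceil_lt_add_one (show 0 ≤ X by linarith)
  have σ1 := Nat.le_ceil δ
  have σ2 := Nat.ceil_lt_add_one (show 0 ≤ δ by linarith)
  set κ := ⌈X⌉₊
  set σ := ⌈δ⌉₊
  have hκδ : (κ : ℝ) * δ ≤ (X + 1) * δ := by gcongr
  have hκδ0 : 0 ≤ (κ : ℝ) * δ := by positivity
  have α1 := Nat.le_ceil ((κ : ℝ) * δ + 4 * δ)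
  have α2 := Nat.ceil_lt_add_one (show 0 ≤ (κ : ℝ) * δ + 4 * δ by linarith)
  set α := ⌈(κ : ℝ) * δ + 4 * δ⌉₊
  have α3 : (α : ℝ) ≤ 2.4 * (X * δ) := by linarith
  have r1 := Nat.le_ceil (D / 4)
  have r2 := Nat.ceil_lt_add_one (show 0 ≤ D / 4 by linarith)
  set r₀ := ⌈D / 4⌉₊
  have hy : D / (36 * δ) * (36 * δ) = D := div_mul_cancel₀ _ (by linarith)
  have hy1 : 7 ≤ D / (36 * δ) := by
    rw [le_div_iff₀ (by linarith)]; linarith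
  obtain ⟨M, hM⟩ : ∃ M, ⌈D / (36 * δ)⌉₊ = M + 1 :=
    Nat.exists_eq_succ_of_ne_zero (Nat.ceil_pos.2 (by linarith)).ne'
  have M1 := Nat.le_ceil (D / (36 * δ))
  have M2 := Nat.ceil_lt_add_one (show 0 ≤ D / (36 * δ) by linarith)
  rw [hM] at M1 M2
  push_cast at M1 M2
  set y := D / (36 * δ) with hydef
  have hMy : (M : ℝ) < y := by linarith
  have hM50 : D / (50 * δ) ≤ M := by
    have : D / (50 * δ) = 36 / 50 * y := by
      rw [hydef]; field_simp
    rw [this]; linarith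
  have hK : (D + 1) * ((d : ℝ) + 1) ^ α ≤ B / 2 * (1 + B) ^ r₀ := by
    have k1 : ((d : ℝ) + 1) ^ α ≤ 2 ^ (P / 8) := by
      calc ((d : ℝ) + 1) ^ α ≤ (2 * d) ^ α := by gcongr; linarith
        _ = (2 : ℝ) ^ (Lg * α) := by
          rw [Real.rpow_mul (by norm_num), hLpow, Real.rpow_natCast]
        _ ≤ 2 ^ (P / 8) := by
          refine Real.rpow_le_rpow_of_exponent_le (by norm_num) ?_
          have : Lg * α ≤ Lg * (2.4 * (X * δ)) := by gcongr
          rw [hPX] at hP1 ⊢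
          linarith
    have k2 : (2 : ℝ) ^ (P / 4) ≤ (1 + B) ^ r₀ :=
      two_rpow_le_one_add_pow hβ0.le hβ1 hβB (by
        have : β * (D / 4) ≤ β * r₀ := by gcongr
        linarith)
    have k3 : (2 : ℝ) ^ (P / 4) = 2 ^ (P / 8) * 2 ^ (P / 8) := by
      rw [← Real.rpow_add (by norm_num)]; congr 1; ring
    calc (D + 1) * ((d : ℝ) + 1) ^ α ≤ (2 * D) * 2 ^ (P / 8) := by gcongr; linarith
      _ = (1 / D) / 2 * (2 ^ (P / 8) * (4 * D ^ 2)) := by field_simp; ring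
      _ ≤ (1 / D) / 2 * (2 ^ (P / 8) * 2 ^ (P / 8)) := by gcongr
      _ = (1 / D) / 2 * 2 ^ (P / 4) := by rw [k3]
      _ ≤ B / 2 * (1 + B) ^ r₀ := by
        gcongr
        rw [div_le_iff₀ (by linarith)]
        have : β * D ≤ B * D := by gcongr
        linarith
  have key := h.one_add_half_pow_le hG hδ hd hB0 hB (u := u) (v := v) (r₀ := r₀) (α := α)
    (σ := σ) (κ := κ) (M := M) (by linarith) (by linarith) (by
      have : (M : ℝ) * (4 * δ + 1) ≤ M * (6 * δ) := by gcongr; linarith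
      have : (M : ℝ) * (6 * δ) < y * (6 * δ) := by gcongr
      linarith) hK
  have key2 := Real.log_le_log (by positivity) (key.trans (half_le_self (Nat.cast_nonneg _)))
  rw [Real.log_pow] at key2
  have hlogB : B / 3 ≤ Real.log (1 + B / 2) := by
    refine le_trans ?_ (Real.le_log_one_add_of_nonneg (by linarith))
    rw [div_le_div_iff₀ (by norm_num) (by linarith)]
    nlinarith
  have hk : D * 2 ^ X / 50 ≤ ((M * (σ * 2 ^ κ) : ℕ) : ℝ) := by
    push_cast
    calc D * 2 ^ X / 50 = D / (50 * δ) * (δ * 2 ^ X) := by field_simp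
      _ ≤ M * (σ * 2 ^ κ) := by
        gcongr
        rw [← Real.rpow_natCast]
        exact Real.rpow_le_rpow_of_exponent_le (by norm_num) κ1
  have hQ0 : 0 ≤ Q := by positivity
  have hQlog : Q / 3 ≤ Real.log (1 + B / 2) := le_trans (by gcongr) hlogB
  have hfin : D * 2 ^ X / 50 * (Q / 3) ≤
      ((M * (σ * 2 ^ κ) : ℕ) : ℝ) * Real.log (1 + B / 2) := by
    gcongr
  have hQe : D * 2 ^ X / 50 * (Q / 3) = 500 / 150 * Real.log (Fintype.card V) := by
    rw [hQdef]; field_simp; norm_num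
  linarith only [hQe, hfin, key2, hlog]

end Bounds

lemma exists_forall_four_mul_sq_le {μ : ℝ} (hμ0 : 0 < μ) :
    ∃ N : ℕ, ∀ D : ℕ, N ≤ D → 4 * (D : ℝ) ^ 2 ≤ 2 ^ ((D : ℝ) ^ μ / 8) := by
  have hlog : 0 < Real.log 2 / 8 := by have := Real.log_pos one_lt_two; positivity
  have h := ((tendsto_rpow_mul_exp_neg_mul_atTop_nhds_zero (2 / μ) _ hlog).comp
    (tendsto_rpow_atTop hμ0)).comp (tendsto_natCast_atTop_atTop (R := ℝ))
  have h2 := h.eventually (gt_mem_nhds (show (0 : ℝ) < 1 / 4 by norm_num))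
  obtain ⟨N, hN⟩ := Filter.eventually_atTop.1 h2
  refine ⟨N, fun D hD => ?_⟩
  have h3 := hN D hD
  simp only [Function.comp_apply] at h3
  rw [← Real.rpow_mul (Nat.cast_nonneg _), mul_div_cancel₀ _ hμ0.ne', neg_mul, Real.exp_neg,
    ← div_eq_mul_inv, div_lt_iff₀ (Real.exp_pos _)] at h3
  rw [Real.rpow_def_of_pos two_pos]
  have e : Real.log 2 * ((D : ℝ) ^ μ / 8) = Real.log 2 / 8 * (D : ℝ) ^ μ := by ring
  rw [e]
  norm_num at h3
  linarith

/-- The bound of the minimum expansion in terms of the diameter, in strict form. -/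
lemma exists_forall_minExpansion_lt (μ : ℝ) (hμ0 : 0 < μ) (hμ1 : μ < 1) :
    ∃ n₀ : ℕ, 16 ≤ n₀ ∧ ∀ (V : Type) [Fintype V] (G : SimpleGraph V) [DecidableRel G.Adj]
      (δ : ℝ) (d : ℕ),
      G.Connected → n₀ ≤ Fintype.card V → (1 / 2 : ℝ) ≤ δ → IsHyp G δ → 2 < d →
      (∀ v : V, G.degree v ≤ d) →
      logb 2 (Fintype.card V) / logb 2 d ≤ (diam G : ℝ) →
      minExpansion G < 8 * Real.log ((Fintype.card V : ℝ) / 2) / (diam G : ℝ) ∧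
        minExpansion G < max ((1 / (diam G : ℝ)) ^ (1 - μ))
          (500 * Real.log (Fintype.card V) /
            ((diam G : ℝ) * (2 : ℝ) ^ ((diam G : ℝ) ^ μ / (28 * δ * logb 2 (2 * d))))) := by
  obtain ⟨N, hN⟩ := exists_forall_four_mul_sq_le hμ0
  refine ⟨max 16 (2 ^ (N ^ 2)), le_max_left _ _, ?_⟩
  intro V _ G _ δ d hG hn hδ h hd2 hd hE
  have hn16 : 16 ≤ Fintype.card V := (le_max_left _ _).trans hn
  have hnR : (16 : ℝ) ≤ Fintype.card V := by exact_mod_cast hn16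
  have hd3 : (3 : ℝ) ≤ d := by exact_mod_cast hd2
  have hld : 0 < logb 2 (d : ℝ) := Real.logb_pos (by norm_num) (by linarith)
  have hln : 0 < logb 2 (Fintype.card V : ℝ) := Real.logb_pos (by norm_num) (by linarith)
  have hlogn : 0 < Real.log (Fintype.card V : ℝ) := Real.log_pos (by linarith)
  have := hG.nonempty
  obtain ⟨u, v, huv⟩ := exists_dist_eq_diam G
  rw [← huv] at hE ⊢
  have hDpos : (0 : ℝ) < G.dist u v := lt_of_lt_of_le (by positivity) hE
  have hD0 : 0 < G.dist u v := by exact_mod_cast hDpos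
  have h1 := PaperHyp.minExpansion_lt_of_dist hG hn16 hD0
  refine ⟨h1, ?_⟩
  rcases le_or_gt ((G.dist u v : ℝ) ^ μ / (28 * δ * logb 2 (2 * d))) 5 with hX | hX
  · refine lt_max_of_lt_right (h1.trans_le ?_)
    have hpow : (2 : ℝ) ^ ((G.dist u v : ℝ) ^ μ / (28 * δ * logb 2 (2 * d))) ≤ 32 := by
      refine (Real.rpow_le_rpow_of_exponent_le (by norm_num) hX).trans ?_
      norm_num
    have hL : Real.log ((Fintype.card V : ℝ) / 2) ≤ Real.log (Fintype.card V) :=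
      Real.log_le_log (by linarith) (by linarith)
    rw [div_le_div_iff₀ hDpos (by positivity)]
    calc 8 * Real.log ((Fintype.card V : ℝ) / 2) * (G.dist u v *
          (2 : ℝ) ^ ((G.dist u v : ℝ) ^ μ / (28 * δ * logb 2 (2 * d))))
        ≤ 8 * Real.log (Fintype.card V) * (G.dist u v * 32) := by gcongr
      _ ≤ 500 * Real.log (Fintype.card V) * G.dist u v := by
        have : 0 < Real.log (Fintype.card V) * G.dist u v := by positivity
        linarith
  · refine h.minExpansion_lt_of_dist hG hδ hd2 hd hn16 hD0 hμ0 hμ1 hX (hN _ ?_)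
    have hD1 : (1 : ℝ) ≤ G.dist u v := by exact_mod_cast hD0
    have hll : logb 2 (d : ℝ) ≤ logb 2 (2 * d) :=
      Real.logb_le_logb_of_le (by norm_num) (by linarith) (by linarith)
    have hPd : logb 2 (d : ℝ) ≤ (G.dist u v : ℝ) ^ μ := by
      rw [lt_div_iff₀ (by have : 0 < logb 2 (2 * (d : ℝ)) := by linarith
                          positivity)] at hX
      have : 1 / 2 * logb 2 (2 * (d : ℝ)) ≤ δ * logb 2 (2 * d) := by gcongr; linarith
      linarith
    have hPD : (G.dist u v : ℝ) ^ μ ≤ G.dist u v := by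
      simpa using Real.rpow_le_rpow_of_exponent_le hD1 hμ1.le
    rw [div_le_iff₀ hld] at hE
    have hnD : logb 2 (Fintype.card V : ℝ) ≤ (G.dist u v : ℝ) ^ 2 := by
      rw [sq]
      exact hE.trans (by gcongr; linarith)
    have hNn : (2 : ℝ) ^ (N ^ 2) ≤ Fintype.card V := by
      exact_mod_cast (le_max_right _ _).trans hn
    have hNl : ((N : ℝ)) ^ 2 ≤ logb 2 (Fintype.card V : ℝ) := by
      rw [Real.le_logb_iff_rpow_le (by norm_num) (by linarith)]
      exact_mod_cast hNn
    have : (N : ℝ) ≤ G.dist u v := le_of_sq_le_sq (hNl.trans hnD) hDpos.le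
    exact_mod_cast this

theorem min_expansion_bound (μ : ℝ) (hμ0 : 0 < μ) (hμ1 : μ < 1) :
    ∃ n₀ : ℕ, ∀ (V : Type) [Fintype V] (G : SimpleGraph V) [DecidableRel G.Adj]
      (δ : ℝ) (d : ℕ),
      G.Connected → n₀ ≤ Fintype.card V → (1 / 2 : ℝ) ≤ δ → IsHyp G δ → 2 < d →
      (∀ v : V, G.degree v ≤ d) →
      logb 2 (Fintype.card V) / logb 2 d ≤ (diam G : ℝ) →
      minExpansion G ≤
          min (8 * Real.log ((Fintype.card V : ℝ) / 2) / (diam G : ℝ))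
            (max ((1 / (diam G : ℝ)) ^ (1 - μ))
              (500 * Real.log (Fintype.card V) /
                ((diam G : ℝ) *
                  (2 : ℝ) ^ ((diam G : ℝ) ^ μ / (28 * δ * logb 2 (2 * d)))))) ∧
        minExpansion G <
          max ((logb 2 d / logb 2 (Fintype.card V)) ^ (1 - μ))
            (500 * logb 2 d /
              (2 : ℝ) ^ ((logb 2 (Fintype.card V)) ^ μ / (28 * δ * (logb 2 (2 * d)) ^ (1 + μ)))) := by
  obtain ⟨n₀, hn₀, H⟩ := exists_forall_minExpansion_lt μ hμ0 hμ1
  refine ⟨n₀, ?_⟩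
  intro V _ G _ δ d hG hn hδ h hd2 hd hE
  obtain ⟨h1, h2⟩ := H V G δ d hG hn hδ h hd2 hd hE
  refine ⟨le_min h1.le h2.le, h2.trans_le ?_⟩
  have hnR : (16 : ℝ) ≤ Fintype.card V := by exact_mod_cast hn₀.trans hn
  have hd3 : (3 : ℝ) ≤ d := by exact_mod_cast hd2
  have hld : 0 < logb 2 (d : ℝ) := Real.logb_pos (by norm_num) (by linarith)
  have hll : logb 2 (d : ℝ) ≤ logb 2 (2 * d) :=
    Real.logb_le_logb_of_le (by norm_num) (by linarith) (by linarith)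
  have hln : 0 < logb 2 (Fintype.card V : ℝ) := Real.logb_pos (by norm_num) (by linarith)
  have hDpos : (0 : ℝ) < diam G := lt_of_lt_of_le (by positivity) hE
  have hl2d : 0 < logb 2 (2 * (d : ℝ)) := by linarith
  refine max_le_max ?_ ?_
  · refine Real.rpow_le_rpow (by positivity) ?_ (by linarith)
    rw [div_le_div_iff₀ hDpos hln]
    rw [div_le_iff₀ hld] at hE
    linarith
  · have hexp : logb 2 (Fintype.card V : ℝ) ^ μ / (28 * δ * logb 2 (2 * (d : ℝ)) ^ (1 + μ)) ≤
        (diam G : ℝ) ^ μ / (28 * δ * logb 2 (2 * d)) := by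
      have e : logb 2 (Fintype.card V : ℝ) ^ μ / (28 * δ * logb 2 (2 * (d : ℝ)) ^ (1 + μ)) =
          (logb 2 (Fintype.card V : ℝ) / logb 2 (2 * d)) ^ μ / (28 * δ * logb 2 (2 * d)) := by
        rw [Real.rpow_add hl2d, Real.rpow_one, Real.div_rpow hln.le hl2d.le]
        field_simp
      rw [e]
      have : logb 2 (Fintype.card V : ℝ) / logb 2 (2 * d) ≤ diam G :=
        le_trans (by gcongr) hE
      gcongr
    have hlog : Real.log (Fintype.card V) ≤ diam G * logb 2 d := by
      rw [div_le_iff₀ hld] at hE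
      refine le_trans ?_ hE
      rw [Real.logb, le_div_iff₀ (Real.log_pos one_lt_two)]
      have := Real.log_pos (show (1 : ℝ) < Fintype.card V by linarith)
      nlinarith [Real.log_two_lt_d9]
    calc 500 * Real.log (Fintype.card V) /
          ((diam G : ℝ) * (2 : ℝ) ^ ((diam G : ℝ) ^ μ / (28 * δ * logb 2 (2 * d))))
        ≤ 500 * (diam G * logb 2 d) /
          ((diam G : ℝ) * (2 : ℝ) ^ ((diam G : ℝ) ^ μ / (28 * δ * logb 2 (2 * d)))) := by
          gcongr
      _ = 500 * logb 2 d / (2 : ℝ) ^ ((diam G : ℝ) ^ μ / (28 * δ * logb 2 (2 * d))) := by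
          field_simp
      _ ≤ _ := by
          gcongr
          norm_num

end PaperHyp
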